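/- arXiv:2309.03293 — 2 statements merged into one kernel-verified Lean document; each statement's English description precedes it below -/
import Mathlib

section
/- Let E be a real inner product space, c ∈ ℝ, v ∈ E with ‖v‖ < |c|. Define H := Real.sqrt (c² − ‖v‖²), the dynamical lapse N := c/H, and the dynamical shift N⃗ := −H⁻¹ • v. Then N² • v + (N·c + ⟪N⃗, v⟫ + H·‖N⃗‖²) • N⃗ = 0 in E. -/
open RealInnerProductSpace

/-- With `H = √(c² − ‖v‖²)`, the dynamical lapse `N = c/H` and dynamical shift
`N⃗ = −H⁻¹ • v` satisfy the pointwise cancellation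
`N² • v + (N·c + ⟪N⃗, v⟫ + H·‖N⃗‖²) • N⃗ = 0`. -/
theorem bulk_term_cancellation
    {E : Type*} [NormedAddCommGroup E] [InnerProductSpace ℝ E]
    (c : ℝ) (v : E) (h : ‖v‖ < |c|) :
    let H : ℝ := Real.sqrt (c ^ 2 - ‖v‖ ^ 2)
    let N : ℝ := c / H
    let Nvec : E := -(H⁻¹ • v)
    N ^ 2 • v + (N * c + ⟪Nvec, v⟫ + H * ‖Nvec‖ ^ 2) • Nvec = 0 := by
  intro H N Nvec
  have hsq : ‖v‖ ^ 2 < c ^ 2 := sq_lt_sq.2 (by rwa [abs_norm])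
  have hH : H ≠ 0 := (Real.sqrt_pos.2 (sub_pos.2 hsq)).ne'
  have hinner : ⟪Nvec, v⟫ = -(H⁻¹ * ‖v‖ ^ 2) := by
    rw [inner_neg_left, real_inner_smul_left, real_inner_self_eq_norm_sq]
  have hnorm : ‖Nvec‖ ^ 2 = H⁻¹ ^ 2 * ‖v‖ ^ 2 := by
    rw [norm_neg, norm_smul, mul_pow, Real.norm_eq_abs, sq_abs]
  have hcoeff : N * c + ⟪Nvec, v⟫ + H * ‖Nvec‖ ^ 2 = c ^ 2 / H := by
    rw [hinner, hnorm]
    simp only [N]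
    field_simp
    ring
  rw [hcoeff, smul_neg, smul_smul, ← sub_eq_add_neg, ← sub_smul]
  have hzero : N ^ 2 - c ^ 2 / H * H⁻¹ = 0 := by
    simp only [N]
    field_simp
    ring
  rw [hzero, zero_smul]
end

section
/- Let P and Q̃ be real polynomials with P(1) = 1, and define Q : ℝ → ℝ by Q(s) = P(s)·(1/2)·Real.log((1+s)/(1−s)) + Q̃(s). Then the function s ↦ (1/2)·(1−s²)²·deriv (deriv Q) s tends to 1 as s → 1 within the interval (−1, 1). -/
open Filter

/-- The derivative of `artanh s = (1/2) log ((1+s)/(1-s))` on `(-1, 1)`. -/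
theorem hasDerivAt_half_log_div {s : ℝ} (hs : s ∈ Set.Ioo (-1 : ℝ) 1) :
    HasDerivAt (fun s : ℝ => (1 / 2) * Real.log ((1 + s) / (1 - s))) (1 - s ^ 2)⁻¹ s := by
  have h₁ : 0 < 1 + s := by linarith [hs.1]
  have h₂ : 0 < 1 - s := by linarith [hs.2]
  have h₃ : 1 - s ^ 2 ≠ 0 := (by nlinarith [mul_pos h₁ h₂] : 0 < 1 - s ^ 2).ne'
  refine (((((hasDerivAt_id' s).const_add 1).fun_div ((hasDerivAt_id' s).const_sub 1) h₂.ne').log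
    (div_pos h₁ h₂).ne').const_mul (1 / 2)).congr_deriv ?_
  field_simp
  ring

/-- The derivative of `artanh' s = (1 - s²)⁻¹` on `(-1, 1)`. -/
theorem hasDerivAt_inv_one_sub_sq {s : ℝ} (hs : s ∈ Set.Ioo (-1 : ℝ) 1) :
    HasDerivAt (fun s : ℝ => (1 - s ^ 2)⁻¹) (2 * s / (1 - s ^ 2) ^ 2) s := by
  have h : 1 - s ^ 2 ≠ 0 := (by nlinarith [hs.1, hs.2] : 0 < 1 - s ^ 2).ne'
  refine (((hasDerivAt_pow 2 s).const_sub 1).fun_inv h).congr_deriv ?_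
  simp

/-- The second derivative of `P · artanh + R` on `(-1, 1)`, for polynomials `P` and `R`. -/
theorem deriv_deriv_eval_mul_half_log_div_add_eval (P R : Polynomial ℝ) {s : ℝ}
    (hs : s ∈ Set.Ioo (-1 : ℝ) 1) :
    deriv (deriv (fun s : ℝ =>
        P.eval s * ((1 / 2) * Real.log ((1 + s) / (1 - s))) + R.eval s)) s =
      P.derivative.derivative.eval s * ((1 / 2) * Real.log ((1 + s) / (1 - s))) +
        2 * P.derivative.eval s * (1 - s ^ 2)⁻¹ + P.eval s * (2 * s / (1 - s ^ 2) ^ 2) +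
        R.derivative.derivative.eval s := by
  have hfirst : deriv (fun s : ℝ =>
        P.eval s * ((1 / 2) * Real.log ((1 + s) / (1 - s))) + R.eval s) =ᶠ[nhds s]
      fun s => P.derivative.eval s * ((1 / 2) * Real.log ((1 + s) / (1 - s))) +
        P.eval s * (1 - s ^ 2)⁻¹ + R.derivative.eval s := by
    filter_upwards [isOpen_Ioo.mem_nhds hs] with t ht
    exact (((P.hasDerivAt t).fun_mul (hasDerivAt_half_log_div ht)).fun_add
      (R.hasDerivAt t)).deriv
  rw [hfirst.deriv_eq, ((((P.derivative.hasDerivAt s).fun_mul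
    (hasDerivAt_half_log_div hs)).fun_add ((P.hasDerivAt s).fun_mul
    (hasDerivAt_inv_one_sub_sq hs))).fun_add (R.derivative.hasDerivAt s)).deriv]
  ring

/-- For a Legendre-type function `Q(s) = P(s)·(1/2)·log((1+s)/(1−s)) + Q̃(s)` with
polynomials `P`, `Q̃` and `P(1) = 1`, the quantity `Ψ(s) = (1/2)(1−s²)² Q''(s)`
tends to `1` as `s → 1` within `(−1, 1)`. -/
theorem legendre_psi_limit (P Qt : Polynomial ℝ) (hP : P.eval 1 = 1) :
    Tendsto
      (fun s : ℝ =>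
        (1 / 2) * (1 - s ^ 2) ^ 2 *
          deriv (deriv (fun s : ℝ =>
            P.eval s * ((1 / 2) * Real.log ((1 + s) / (1 - s))) + Qt.eval s)) s)
      (nhdsWithin 1 (Set.Ioo (-1 : ℝ) 1)) (nhds 1) := by
  set G : ℝ → ℝ := fun s =>
    (1 / 4) * P.derivative.derivative.eval s * (1 + s) ^ 2 *
        ((1 - s) ^ 2 * Real.log (1 + s) - (1 - s) * ((1 - s) * Real.log (1 - s))) +
      (1 - s ^ 2) * P.derivative.eval s + s * P.eval s +
      (1 / 2) * (1 - s ^ 2) ^ 2 * Qt.derivative.derivative.eval s with hG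
  have hcont : ContinuousAt G 1 := by
    have hlog : ContinuousAt (fun s : ℝ => Real.log (1 + s)) 1 :=
      ContinuousAt.log (by fun_prop) (by norm_num)
    have hmul : ContinuousAt (fun s : ℝ => (1 - s) * Real.log (1 - s)) 1 :=
      (Real.continuous_mul_log.comp (continuous_const.sub continuous_id)).continuousAt
    fun_prop
  have hG1 : G 1 = 1 := by simp [hG, hP]
  have hlim : Tendsto G (nhdsWithin 1 (Set.Ioo (-1 : ℝ) 1)) (nhds 1) := by
    simpa only [hG1] using hcont.tendsto.mono_left nhdsWithin_le_nhds
  refine hlim.congr' ?_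
  filter_upwards [self_mem_nhdsWithin] with s hs
  have h₁ : 1 + s ≠ 0 := (by linarith [hs.1] : 0 < 1 + s).ne'
  have h₂ : 1 - s ≠ 0 := (by linarith [hs.2] : 0 < 1 - s).ne'
  have h₃ : 1 - s ^ 2 ≠ 0 := (by nlinarith [hs.1, hs.2] : 0 < 1 - s ^ 2).ne'
  rw [deriv_deriv_eval_mul_half_log_div_add_eval P Qt hs, Real.log_div h₁ h₂]
  simp only [hG]
  field_simp
  ring
end
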